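/- Let G be a finite nonsolvable QSI group of minimal order among all finite nonsolvable QSI groups, and let N be a minimal normal subgroup of G. Then: N is the unique minimal normal subgroup of G; N is isomorphic to S^m for some non-abelian finite simple group S and some m ≥ 1; G/N is solvable; the centralizer C_G(N) is trivial; and consequently the conjugation action gives an embedding of G into Aut(N). -/

import Mathlib

open scoped BigOperators Classical

noncomputable section

/-- `χ` is the character of some finite-dimensional complex representation of `G`. -/
def IsCharacter (G : Type) [Monoid G] (χ : G → ℂ) : Prop :=
  ∃ V : FDRep ℂ G, χ = V.character

/-- `χ` is an irreducible complex character of `G`, i.e. the character of a simple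
finite-dimensional complex representation of `G`. -/
def IsIrreducibleCharacter (G : Type) [Monoid G] (χ : G → ℂ) : Prop :=
  ∃ V : FDRep ℂ G, CategoryTheory.Simple V ∧ χ = V.character

/-- The class function of `G` induced from the function `φ` on the subgroup `U`:
`φ^G(g) = |U|⁻¹ · ∑_{y ∈ G, y⁻¹gy ∈ U} φ(y⁻¹gy)`. -/
def inducedChar {G : Type} [Group G] [Finite G] (U : Subgroup G) (φ : ↥U → ℂ) : G → ℂ :=
  fun g => (Nat.card ↥U : ℂ)⁻¹ *
    ∑ᶠ y : G, if h : y⁻¹ * g * y ∈ U then φ ⟨y⁻¹ * g * y, h⟩ else 0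

/-- `χ` is quasi solvably induced (QSI) from the subgroup `U` and `φ ∈ Irr(U)`:
there is `k ≥ 1` with `k·χ = φ^G`, and `U/ker(φ)` is solvable, where
`ker(φ) = {u ∈ U | φ(u) = φ(1)}`. -/
def IsQSIFrom {G : Type} [Group G] [Finite G] (χ : G → ℂ) (U : Subgroup G)
    (φ : ↥U → ℂ) : Prop :=
  IsIrreducibleCharacter ↥U φ ∧
  (∃ k : ℕ, 0 < k ∧ ∀ g : G, (k : ℂ) * χ g = inducedChar U φ g) ∧
  ∃ (K : Subgroup ↥U) (hK : K.Normal), (K : Set ↥U) = {u : ↥U | φ u = φ 1} ∧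
    (letI := hK; IsSolvable (↥U ⧸ K))

/-- `χ` is QSI from some subgroup `U ≤ G` and some `φ ∈ Irr(U)`. -/
def IsQSI {G : Type} [Group G] [Finite G] (χ : G → ℂ) : Prop :=
  ∃ (U : Subgroup G) (φ : ↥U → ℂ), IsQSIFrom χ U φ

/-- A finite group `G` is QSI if every irreducible complex character of `G` is QSI. -/
def IsQSIGroup (G : Type) [Group G] [Finite G] : Prop :=
  ∀ χ : G → ℂ, IsIrreducibleCharacter G χ → IsQSI χ

/-- The usual inner product of class functions on a finite group. -/
def charInner {H : Type} [Group H] [Finite H] (α β : H → ℂ) : ℂ :=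
  (Nat.card H : ℂ)⁻¹ * ∑ᶠ h : H, α h * starRingEnd ℂ (β h)


open CategoryTheory Module

theorem aux_sum_comp {A B : Type} [Group A] [Group B] [Fintype A] [Fintype B] (f : A →* B)
    (hf : Function.Surjective f) (F : B → ℂ) :
    (Fintype.card B : ℂ) * ∑ a, F (f a) = (Fintype.card A : ℂ) * ∑ b, F b := by
  have hfib : ∀ b : B, (Finset.univ.filter fun a => f a = b).card
      = (Finset.univ.filter fun a => f a = 1).card := fun b =>
    MonoidHom.card_fiber_eq_of_mem_range f (hf b) ⟨1, map_one f⟩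
  have h1 : ∀ F : B → ℂ, ∑ a, F (f a)
      = ((Finset.univ.filter fun a => f a = 1).card : ℂ) * ∑ b, F b := by
    intro F
    rw [← Finset.sum_fiberwise Finset.univ f, Finset.mul_sum]
    refine Finset.sum_congr rfl fun b _ => ?_
    rw [Finset.sum_congr rfl (g := fun _ => F b)]
    · rw [Finset.sum_const, hfib, nsmul_eq_mul]
    · intro a ha
      rw [(Finset.mem_filter.1 ha).2]
  have h2 := h1 (fun _ => 1)
  simp only [Finset.sum_const, Finset.card_univ, nsmul_eq_mul, mul_one] at h2
  rw [h1, h2]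
  ring

theorem aux_char_norm_le {A : Type} [Group A] [Finite A] (V : FDRep ℂ A) (a : A) :
    ‖V.character a‖ ≤ finrank ℂ V := by
  have hn : 0 < Nat.card A := Nat.card_pos
  have hpow : (V.ρ a) ^ Nat.card A = 1 := by
    rw [← map_pow, pow_card_eq_one', map_one]
  unfold FDRep.character
  have hs : (V.ρ a).charpoly.Splits := IsAlgClosed.splits _
  rw [Module.End.trace_eq_sum_roots_charpoly_of_splits hs]
  have hcard : Multiset.card (V.ρ a).charpoly.roots ≤ finrank ℂ V := by
    rw [← LinearMap.charpoly_natDegree (V.ρ a)]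
    exact Polynomial.card_roots' _
  have hroot : ∀ z ∈ (V.ρ a).charpoly.roots, ‖z‖ = 1 := by
    intro z hz
    have hz1 : (V.ρ a).charpoly.IsRoot z := Polynomial.isRoot_of_mem_roots hz
    rw [← Module.End.hasEigenvalue_iff_isRoot_charpoly] at hz1
    obtain ⟨v, hv⟩ := hz1.exists_hasEigenvector
    have h1 := hv.pow_apply (Nat.card A)
    rw [hpow] at h1
    have h2 : z ^ Nat.card A = 1 := by
      have h3 : (z ^ Nat.card A - 1) • v = 0 := by
        rw [sub_smul, ← h1]; simp
      rcases smul_eq_zero.1 h3 with h | h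
      · exact sub_eq_zero.1 h
      · exact absurd h hv.2
    exact Complex.norm_eq_one_of_pow_eq_one h2 hn.ne'
  calc ‖(V.ρ a).charpoly.roots.sum‖ ≤ ((V.ρ a).charpoly.roots.map fun z => ‖z‖).sum :=
        norm_multiset_sum_le _
    _ = Multiset.card (V.ρ a).charpoly.roots := by
        rw [Multiset.map_congr rfl hroot]; simp
    _ ≤ _ := by exact_mod_cast hcard

theorem aux_simple_iff {A B : Type} [Group A] [Group B] [Finite A] [Finite B] (f : A →* B)
    (hf : Function.Surjective f) (V : FDRep ℂ A) (W : FDRep ℂ B)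
    (h : ∀ a, W.character (f a) = V.character a) : Simple V ↔ Simple W := by
  have := Fintype.ofFinite A
  have := Fintype.ofFinite B
  rw [FDRep.simple_iff_char_is_norm_one, FDRep.simple_iff_char_is_norm_one]
  have h1 := aux_sum_comp f hf (fun b => W.character b * W.character b⁻¹)
  simp only [← map_inv, h] at h1
  have hA : (Fintype.card A : ℂ) ≠ 0 := by exact_mod_cast Fintype.card_ne_zero
  have hB : (Fintype.card B : ℂ) ≠ 0 := by exact_mod_cast Fintype.card_ne_zero
  simp only [Nat.card_eq_fintype_card]
  constructor
  · intro h2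
    rw [h2, mul_comm] at h1
    exact (mul_left_cancel₀ hA h1).symm
  · intro h2
    rw [h2, mul_comm (Fintype.card A : ℂ)] at h1
    exact mul_left_cancel₀ hB h1

theorem aux_ker_trivial {A : Type} [Group A] [Finite A] (V : FDRep ℂ A) (M : Subgroup A)
    (h : ∀ a ∈ M, V.character a = V.character 1) (a : A) (ha : a ∈ M) : V.ρ a = 1 := by
  have := Fintype.ofFinite M
  let σ : Representation ℂ M V := V.ρ.comp M.subtype
  have hc : (Nat.card M : ℂ) ≠ 0 := by exact_mod_cast Nat.card_pos.ne'
  have : Invertible (Nat.card M : ℂ) := invertibleOfNonzero hc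
  have h1 := Representation.card_inv_mul_sum_char_eq_finrank σ
  have h2 : ∀ m : M, σ.character m = (finrank ℂ V : ℂ) := by
    intro m
    rw [← FDRep.char_one, ← h m m.2]
    rfl
  simp only [h2, Finset.sum_const, Finset.card_univ, nsmul_eq_mul] at h1
  rw [← Nat.card_eq_fintype_card, inv_mul_cancel_left₀ hc] at h1
  have h3 : σ.invariants = ⊤ := Submodule.eq_top_of_finrank_eq (by exact_mod_cast h1.symm)
  ext v
  have h4 : v ∈ σ.invariants := by rw [h3]; trivial
  exact h4 ⟨a, ha⟩

theorem aux_descend {A B : Type} [Group A] [Group B] [Finite A] [Finite B] (f : A →* B)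
    (hf : Function.Surjective f) (V : FDRep ℂ A)
    (h : ∀ a ∈ f.ker, V.character a = V.character 1) :
    ∃ W : FDRep ℂ B, ∀ a, W.character (f a) = V.character a := by
  have hk : ∀ a ∈ f.ker, V.ρ a = 1 := fun a ha => aux_ker_trivial V f.ker h a ha
  have hwd : ∀ a a', f a = f a' → V.ρ a = V.ρ a' := by
    intro a a' haa
    have h1 : a * a'⁻¹ ∈ f.ker := by
      rw [MonoidHom.mem_ker, map_mul, map_inv, haa, mul_inv_cancel]
    have h2 := hk _ h1
    calc V.ρ a = V.ρ (a * a'⁻¹ * a') := by rw [inv_mul_cancel_right]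
      _ = V.ρ a' := by rw [map_mul, h2, one_mul]
  let s := Function.surjInv hf
  have hs : ∀ b, f (s b) = b := Function.surjInv_eq hf
  let τ : Representation ℂ B V :=
    { toFun := fun b => V.ρ (s b)
      map_one' := by
        rw [← map_one V.ρ]; exact hwd _ _ (by rw [hs, map_one])
      map_mul' := fun x y => by
        rw [← map_mul V.ρ]; exact hwd _ _ (by rw [hs, map_mul, hs, hs]) }
  refine ⟨FDRep.of τ, fun a => ?_⟩
  have : τ (f a) = V.ρ a := hwd _ _ (hs _)
  unfold FDRep.character
  rw [← this]
  rfl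

theorem aux_quotient {G Q : Type} [Group G] [Finite G] [Group Q] [Finite Q] (π : G →* Q)
    (hπ : Function.Surjective π) (hG : IsQSIGroup G) : IsQSIGroup Q := by
  have := Fintype.ofFinite G
  have := Fintype.ofFinite Q
  rintro χ ⟨X, hX, rfl⟩
  -- inflate
  let X' : FDRep ℂ G := FDRep.of (V := X) (X.ρ.comp π)
  have hX' : ∀ a, X.character (π a) = X'.character a := fun a => rfl
  obtain ⟨U, φ, ⟨V, hV, hφ⟩, ⟨k, hk, hind⟩, K, hK, hKs, hsol⟩ :=
    hG X'.character ⟨X', (aux_simple_iff π hπ X' X hX').2 hX, rfl⟩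
  subst hφ
  have hUc : (Nat.card U : ℂ) ≠ 0 := by exact_mod_cast Nat.card_pos.ne'
  have hker : ∀ m ∈ π.ker, ∃ h : m ∈ U, V.character ⟨m, h⟩ = V.character 1 := by
    intro m hm
    have hm1 : inducedChar U V.character m = inducedChar U V.character 1 := by
      rw [← hind, ← hind, ← hX', ← hX', (MonoidHom.mem_ker).1 hm, map_one]
    unfold inducedChar at hm1
    have hm2 := mul_left_cancel₀ (inv_ne_zero hUc) hm1
    rw [finsum_eq_sum_of_fintype, finsum_eq_sum_of_fintype] at hm2
    have hm3 := congrArg Complex.re hm2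
    rw [Complex.re_sum, Complex.re_sum] at hm3
    have hone : ∀ y : G, (if h : y⁻¹ * 1 * y ∈ U then V.character ⟨y⁻¹ * 1 * y, h⟩ else 0)
        = (finrank ℂ V : ℂ) := by
      intro y
      have : y⁻¹ * 1 * y ∈ U := by simp
      rw [dif_pos this, ← FDRep.char_one]
      congr 1
      ext; simp
    have hle : ∀ y ∈ (Finset.univ : Finset G),
        (if h : y⁻¹ * m * y ∈ U then V.character ⟨y⁻¹ * m * y, h⟩ else 0).re ≤
        (if h : y⁻¹ * 1 * y ∈ U then V.character ⟨y⁻¹ * 1 * y, h⟩ else 0).re := by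
      intro y _
      rw [hone]
      split_ifs with h
      · exact (Complex.re_le_norm _).trans (by simpa using aux_char_norm_le V _)
      · simp
    have hm4 := (Finset.sum_eq_sum_iff_of_le hle).1 hm3 1 (Finset.mem_univ _)
    rw [hone] at hm4
    have hpos : finrank ℂ V ≠ 0 := by
      intro h0
      have h1 := (FDRep.simple_iff_char_is_norm_one V).1 hV
      have h2 : ∀ u, V.character u = 0 := by
        intro u
        have := aux_char_norm_le V u
        rw [h0] at this
        simpa using this
      simp only [h2, mul_zero, Finset.sum_const_zero] at h1
      exact hUc h1.symm
    have hmU : m ∈ U := by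
      by_contra hmU
      rw [dif_neg (by simpa using hmU)] at hm4
      simp at hm4
      exact hpos (by simpa using hm4.symm)
    refine ⟨hmU, ?_⟩
    rw [dif_pos (by simpa using hmU)] at hm4
    have e : (⟨(1:G)⁻¹ * m * 1, by simpa using hmU⟩ : U) = ⟨m, hmU⟩ := by ext; simp
    rw [e] at hm4
    have hb := aux_char_norm_le V ⟨m, hmU⟩
    rw [FDRep.char_one]
    have h5 : (V.character ⟨m, hmU⟩).re = finrank ℂ V := by simpa using hm4
    have h6 : (V.character ⟨m, hmU⟩).im = 0 := by
      have h7 := Complex.sq_norm (V.character ⟨m, hmU⟩)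
      rw [Complex.normSq_apply] at h7
      rw [h5] at h7
      have h8 : ‖V.character ⟨m, hmU⟩‖ ^ 2 ≤ (finrank ℂ V : ℝ) ^ 2 :=
        pow_le_pow_left₀ (norm_nonneg _) hb 2
      nlinarith
    apply Complex.ext
    · simpa using h5
    · simpa using h6
  have hkU : π.ker ≤ U := fun m hm => (hker m hm).1
  let U' := U.map π
  let f : U →* U' := π.subgroupMap U
  have hf : Function.Surjective f := π.subgroupMap_surjective U
  have hfk : ∀ a ∈ f.ker, V.character a = V.character 1 := by
    intro a ha
    have : (a : G) ∈ π.ker := by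
      have := congrArg Subtype.val (MonoidHom.mem_ker.1 ha)
      exact this
    exact (hker _ this).2
  obtain ⟨W, hW⟩ := aux_descend f hf V hfk
  refine ⟨U', W.character, ⟨W, (aux_simple_iff f hf V W hW).1 hV, rfl⟩, ⟨k, hk, ?_⟩, K.map f,
    hK.map f hf, ?_, ?_⟩
  · intro q
    obtain ⟨g, rfl⟩ := hπ q
    rw [hX', hind]
    unfold inducedChar
    rw [finsum_eq_sum_of_fintype, finsum_eq_sum_of_fintype]
    have hs := aux_sum_comp π hπ (fun y => if h : y⁻¹ * π g * y ∈ U' then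
      W.character ⟨y⁻¹ * π g * y, h⟩ else 0)
    have hterm : ∀ y : G, (if h : (π y)⁻¹ * π g * π y ∈ U' then
        W.character ⟨(π y)⁻¹ * π g * π y, h⟩ else 0) =
        if h : y⁻¹ * g * y ∈ U then V.character ⟨y⁻¹ * g * y, h⟩ else 0 := by
      intro y
      by_cases h : y⁻¹ * g * y ∈ U
      · have h' : (π y)⁻¹ * π g * π y ∈ U' := ⟨_, h, by simp⟩
        rw [dif_pos h, dif_pos h', ← hW]
        congr 1
        ext
        change (π y)⁻¹ * π g * π y = π (y⁻¹ * g * y)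
        simp
      · have h' : ¬ (π y)⁻¹ * π g * π y ∈ U' := by
          rintro ⟨u, hu, hu'⟩
          apply h
          have : u⁻¹ * (y⁻¹ * g * y) ∈ π.ker := by
            rw [MonoidHom.mem_ker, map_mul, map_inv, hu']; simp [mul_assoc]
          simpa using U.mul_mem hu (hkU this)
        rw [dif_neg h, dif_neg h']
    simp only [hterm] at hs
    have hidx : U'.index = U.index := Subgroup.index_map_eq U hπ hkU
    have c1 := U.card_mul_index
    have c2 := U'.card_mul_index
    rw [hidx] at c2
    rw [← Nat.card_eq_fintype_card, ← Nat.card_eq_fintype_card, ← c1, ← c2] at hs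
    have hU'c : (Nat.card U' : ℂ) ≠ 0 := by exact_mod_cast Nat.card_pos.ne'
    have hi : (U.index : ℂ) ≠ 0 := by exact_mod_cast U.index_ne_zero_of_finite
    push_cast at hs
    rw [inv_mul_eq_iff_eq_mul₀ hUc, ← mul_assoc, mul_comm (Nat.card U : ℂ), mul_assoc,
      eq_inv_mul_iff_mul_eq₀ hU'c]
    apply mul_left_cancel₀ hi
    linear_combination hs
  · ext u'
    have hmem : ∀ u : U, u ∈ K ↔ V.character u = V.character 1 := fun u => by
      rw [← SetLike.mem_coe, hKs]; rfl
    have h1 : W.character 1 = V.character 1 := by rw [← hW, map_one]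
    simp only [SetLike.mem_coe, Subgroup.mem_map, Set.mem_ofPred_eq]
    constructor
    · rintro ⟨u, hu, rfl⟩
      rw [hW, h1]; exact (hmem u).1 hu
    · obtain ⟨u, rfl⟩ := hf u'
      intro h
      rw [hW, h1] at h
      exact ⟨u, (hmem u).2 h, rfl⟩
  · have := hK
    have := hK.map f hf
    have : Group.IsSolvable (U ⧸ K) := hsol
    have hsurj : Function.Surjective (QuotientGroup.map K (K.map f) f (Subgroup.le_comap_map f K)) := by
      intro x
      obtain ⟨u', rfl⟩ := QuotientGroup.mk_surjective x
      obtain ⟨u, rfl⟩ := hf u'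
      exact ⟨(u : U ⧸ K), rfl⟩
    exact Group.isSolvable_of_surjective hsurj

theorem aux_minnormal (G : Type) [Group G] [Finite G] (N : Subgroup G) (hN : N.Normal)
    (hNbot : N ≠ ⊥) (hNmin : ∀ M : Subgroup G, M.Normal → M ≠ ⊥ → M ≤ N → M = N)
    (hcent : Subgroup.centralizer (N : Set G) = ⊥) :
    ∃ (S : Type) (instS : Group S) (m : ℕ), 1 ≤ m ∧
      (letI := instS;
        IsSimpleGroup S ∧ (¬ ∀ a b : S, a * b = b * a) ∧
          Nonempty (↥N ≃* (Fin m → S))) := by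
  let P : Subgroup G → Prop := fun S => S ≤ N ∧ S ≠ ⊥ ∧ ∀ n ∈ N, ∀ s ∈ S, n * s * n⁻¹ ∈ S
  have hPN : P N := ⟨le_rfl, hNbot, fun n hn s hs => N.mul_mem (N.mul_mem hn hs) (N.inv_mem hn)⟩
  obtain ⟨S, hS⟩ : ∃ S, Minimal P S := by
    obtain ⟨S, _, hS⟩ := Set.Finite.exists_le_minimal (Set.toFinite {S | P S}) hPN
    exact ⟨S, hS⟩
  let c : G → Subgroup G := fun g => S.map (MulAut.conj g).toMonoidHom
  have hmemc : ∀ g x, x ∈ c g ↔ g⁻¹ * x * g ∈ S := by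
    intro g x
    constructor
    · rintro ⟨s, hs, rfl⟩
      simpa [mul_assoc] using hs
    · intro h
      exact ⟨_, h, by simp [mul_assoc]⟩
  -- conjugates satisfy P
  have hPconj : ∀ (T : Subgroup G) (g : G), P T → P (T.map (MulAut.conj g).toMonoidHom) := by
    rintro T g ⟨h1, h2, h3⟩
    refine ⟨?_, ?_, ?_⟩
    · rintro _ ⟨t, ht, rfl⟩
      exact hN.conj_mem t (h1 ht) g
    · intro h
      apply h2
      exact (Subgroup.map_eq_bot_iff_of_injective T (MulAut.conj g).injective).1 h
    · rintro n hn _ ⟨t, ht, rfl⟩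
      refine ⟨(g⁻¹ * n * g) * t * (g⁻¹ * n * g)⁻¹, h3 _ ?_ t ht, ?_⟩
      · simpa using hN.conj_mem n hn g⁻¹
      · simp [mul_assoc]
  have hcmin : ∀ g, Minimal P (c g) := by
    intro g
    refine ⟨hPconj S g hS.1, ?_⟩
    intro T hT hle
    have h1 := hPconj T g⁻¹ hT
    have h2 : T.map (MulAut.conj g⁻¹).toMonoidHom ≤ S := by
      rintro _ ⟨t, ht, rfl⟩
      have := (hmemc g t).1 (hle ht)
      simpa [mul_assoc] using this
    have h3 := hS.2 h1 h2
    intro x hx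
    obtain ⟨t, ht, htx⟩ := h3 ((hmemc g x).1 hx)
    have : t = x := by simpa [mul_assoc] using htx
    exact this ▸ ht
  -- distinct conjugates commute
  have hcomm : ∀ A B : Subgroup G, Minimal P A → Minimal P B → A ≠ B →
      ∀ x y, x ∈ A → y ∈ B → Commute x y := by
    intro A B hA hB hAB x y hx hy
    have hbot : A ⊓ B = ⊥ := by
      by_contra hne
      have hP : P (A ⊓ B) := ⟨inf_le_left.trans hA.1.1, hne, fun n hn s hs =>
        ⟨hA.1.2.2 n hn s hs.1, hB.1.2.2 n hn s hs.2⟩⟩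
      have h1 := hA.2 hP inf_le_left
      have h2 := hB.2 hP inf_le_right
      exact hAB (le_antisymm (h1.trans inf_le_right) (h2.trans inf_le_left))
    have h1 : x * y * x⁻¹ * y⁻¹ ∈ A ⊓ B := by
      refine ⟨?_, ?_⟩
      · have := A.mul_mem hx (hA.1.2.2 y (hB.1.1 hy) _ (A.inv_mem hx))
        simpa [mul_assoc] using this
      · exact B.mul_mem (hB.1.2.2 x (hA.1.1 hx) y hy) (B.inv_mem hy)
    rw [hbot, Subgroup.mem_bot] at h1
    have h2 := mul_inv_eq_one.1 h1
    exact mul_inv_eq_iff_eq_mul.1 h2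
  let ι := Set.range c
  have : Finite ι := Set.toFinite _
  have : Fintype ι := Fintype.ofFinite ι
  let H : ι → Subgroup G := fun i => i.1
  have hHmin : ∀ i, Minimal P (H i) := by
    rintro ⟨_, g, rfl⟩; exact hcmin g
  have hHcomm : Pairwise fun i j : ι => ∀ x y : G, x ∈ H i → y ∈ H j → Commute x y := by
    intro i j hij
    exact hcomm _ _ (hHmin i) (hHmin j) (fun h => hij (Subtype.ext h))
  have hsup : ⨆ i, H i = N := by
    apply hNmin
    · constructor
      intro n hn g
      have hle : (⨆ i, H i) ≤ (⨆ i, H i).comap (MulAut.conj g).toMonoidHom := by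
        refine iSup_le ?_
        rintro ⟨_, g', rfl⟩ x hx
        have : H ⟨c (g * g'), g * g', rfl⟩ ≤ ⨆ i, H i := le_iSup H _
        apply this
        have hx' := (hmemc g' x).1 hx
        apply (hmemc _ _).2
        simpa [mul_assoc] using hx'
      simpa using hle hn
    · intro h
      have h1 : H ⟨c 1, 1, rfl⟩ ≤ ⨆ i, H i := le_iSup H _
      rw [h, le_bot_iff] at h1
      exact (hcmin 1).1.2.1 h1
    · exact iSup_le fun i => (hHmin i).1.1
  have hcen : ∀ x ∈ N, (∀ i, ∀ y ∈ H i, Commute x y) → x = 1 := by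
    intro x _ h
    have h1 : N ≤ Subgroup.centralizer {x} := by
      rw [← hsup]
      refine iSup_le fun i y hy => ?_
      rw [Subgroup.mem_centralizer_singleton_iff]
      exact (h i y hy).symm
    have h2 : x ∈ Subgroup.centralizer (N : Set G) := by
      rw [Subgroup.mem_centralizer_iff]
      intro y hy
      exact (Subgroup.mem_centralizer_singleton_iff.1 (h1 hy))
    rwa [hcent, Subgroup.mem_bot] at h2
  have hind : iSupIndep H := by
    intro i
    rw [Subgroup.disjoint_def]
    intro x hx hx'
    apply hcen x ((hHmin i).1.1 hx)
    intro j y hy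
    by_cases hij : i = j
    · subst hij
      have h1 : (⨆ j, ⨆ (_ : j ≠ i), H j) ≤ Subgroup.centralizer {y} := by
        refine iSup_le fun j => iSup_le fun hj z hz => ?_
        rw [Subgroup.mem_centralizer_singleton_iff]
        exact hHcomm hj z y hz hy
      exact Subgroup.mem_centralizer_singleton_iff.1 (h1 hx')
    · exact hHcomm hij x y hx hy
  -- the isomorphism
  have hinj := Subgroup.injective_noncommPiCoprod_of_iSupIndep (hcomm := hHcomm) hind
  have hrange := Subgroup.noncommPiCoprod_range (hcomm := hHcomm)
  rw [hsup] at hrange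
  have e1 : (∀ i, H i) ≃* N := (MonoidHom.ofInjective hinj).trans (MulEquiv.subgroupCongr hrange)
  have e2 : ∀ i, Nonempty (H i ≃* S) := by
    rintro ⟨_, g, rfl⟩
    exact ⟨(S.equivMapOfInjective _ (MulAut.conj g).injective).symm⟩
  have e3 : (∀ i, H i) ≃* (ι → S) := MulEquiv.piCongrRight fun i => (e2 i).some
  have e4 : (ι → S) ≃* (Fin (Fintype.card ι) → S) :=
    MulEquiv.arrowCongr (Fintype.equivFin ι) (MulEquiv.refl S)
  have hc1 : c 1 = S := by ext x; simp [hmemc]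
  let i0 : ι := ⟨S, 1, hc1⟩
  have hSc : ∀ i, i ≠ i0 → ∀ x ∈ S, ∀ y ∈ H i, Commute x y := fun i hi x hx y hy =>
    hHcomm (Ne.symm hi) x y hx hy
  refine ⟨S, inferInstance, Fintype.card ι, Fintype.card_pos_iff.2 ⟨i0⟩, ?_, ?_, ⟨?_⟩⟩
  · have : Nontrivial S := (Subgroup.nontrivial_iff_ne_bot S).2 hS.1.2.1
    refine { eq_bot_or_eq_top_of_normal := ?_ }
    intro T hT
    by_cases hTb : T = ⊥
    · exact Or.inl hTb
    right
    let T' : Subgroup G := T.map S.subtype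
    have hT'S : T' ≤ S := Subgroup.map_subtype_le T
    have hPT : P T' := by
      refine ⟨hT'S.trans hS.1.1, ?_, ?_⟩
      · intro h
        exact hTb ((Subgroup.map_eq_bot_iff_of_injective T S.subtype_injective).1 h)
      · have hNle : N ≤ Subgroup.normalizer (T' : Set G) := by
          rw [← hsup]
          refine iSup_le fun i y hy => ?_
          by_cases hi : i = i0
          · subst hi
            have hconj : ∀ z ∈ S, ∀ t ∈ T', z * t * z⁻¹ ∈ T' := by
              rintro z hz _ ⟨t, ht, rfl⟩
              exact ⟨_, hT.conj_mem t ht ⟨z, hz⟩, rfl⟩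
            rw [Subgroup.mem_normalizer_iff]
            intro t
            refine ⟨fun ht => hconj y hy t ht, fun ht => ?_⟩
            have := hconj _ (S.inv_mem hy) _ ht
            simpa [mul_assoc] using this
          · apply Subgroup.centralizer_le_normalizer
            rw [Subgroup.mem_centralizer_iff]
            intro t ht
            exact hSc i hi t (hT'S ht) y hy
        intro n hn t ht
        exact (Subgroup.mem_normalizer_iff.1 (hNle hn) t).1 ht
    have h1 := hS.2 hPT hT'S
    rw [eq_top_iff]
    intro x _
    obtain ⟨t, ht, htx⟩ := h1 x.2
    have : t = x := Subtype.ext htx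
    exact this ▸ ht
  · intro hab
    apply hS.1.2.1
    rw [Subgroup.eq_bot_iff_forall]
    intro x hx
    apply hcen x (hS.1.1 hx)
    intro i y hy
    by_cases hi : i = i0
    · subst hi
      exact congrArg Subtype.val (hab ⟨x, hx⟩ ⟨y, hy⟩)
    · exact hSc i hi x hx y hy
  · exact e1.symm.trans (e3.trans e4)

theorem aux_solv_inf {G : Type} [Group G] (A B : Subgroup G) [A.Normal] [B.Normal]
    (hA : IsSolvable (G ⧸ A)) (hB : IsSolvable (G ⧸ B)) (h : A ⊓ B = ⊥) : IsSolvable G := by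
  have h1 : Group.IsSolvable (G ⧸ A) := hA
  have h2 : Group.IsSolvable (G ⧸ B) := hB
  apply Group.isSolvable_of_isSolvable_injective
    (f := (QuotientGroup.mk' A).prod (QuotientGroup.mk' B))
  rw [← MonoidHom.ker_eq_bot_iff, MonoidHom.ker_prod, QuotientGroup.ker_mk', QuotientGroup.ker_mk', h]

/-- A minimal (with respect to order) finite nonsolvable QSI group `G` has a unique minimal
normal subgroup `N`; moreover `N ≅ S^m` for a non-abelian finite simple group `S` and some
`m ≥ 1`, `G/N` is solvable, `C_G(N) = 1`, and conjugation embeds `G` into `Aut(N)`. -/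
theorem minimal_counterexample_structure (G : Type) [Group G] [Finite G]
    (hQSI : IsQSIGroup G) (hns : ¬ IsSolvable G)
    (hmin : ∀ (H : Type) [Group H] [Finite H],
      IsQSIGroup H → ¬ IsSolvable H → Nat.card G ≤ Nat.card H)
    (N : Subgroup G) (hN : N.Normal) (hNbot : N ≠ ⊥)
    (hNmin : ∀ M : Subgroup G, M.Normal → M ≠ ⊥ → M ≤ N → M = N) :
    (∀ M : Subgroup G, M.Normal → M ≠ ⊥ →
        (∀ M' : Subgroup G, M'.Normal → M' ≠ ⊥ → M' ≤ M → M' = M) → M = N) ∧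
    (∃ (S : Type) (instS : Group S) (m : ℕ), 1 ≤ m ∧
      (letI := instS;
        IsSimpleGroup S ∧ (¬ ∀ a b : S, a * b = b * a) ∧
          Nonempty (↥N ≃* (Fin m → S)))) ∧
    IsSolvable (G ⧸ N) ∧
    Subgroup.centralizer (N : Set G) = ⊥ ∧
    ∃ f : G →* MulAut ↥N, Function.Injective f ∧
      ∀ (g : G) (n : ↥N), ((f g n : ↥N) : G) = g * (n : G) * g⁻¹ := by
  have hq : ∀ M : Subgroup G, ∀ hM : M.Normal, M ≠ ⊥ → IsSolvable (G ⧸ M) := by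
    intro M hM hMb
    by_contra hcon
    have hle := hmin (G ⧸ M) (aux_quotient (QuotientGroup.mk' M)
      (QuotientGroup.mk'_surjective M) hQSI) hcon
    have h1 := M.card_eq_card_quotient_mul_card_subgroup
    have h2 : 1 < Nat.card M := (Subgroup.one_lt_card_iff_ne_bot M).2 hMb
    have h3 : 0 < Nat.card (G ⧸ M) := Nat.card_pos
    nlinarith
  have hinf : ∀ A B : Subgroup G, A.Normal → B.Normal → A ≠ ⊥ → B ≠ ⊥ → A ⊓ B ≠ ⊥ := by
    intro A B hA hB hAb hBb h
    exact hns (aux_solv_inf A B (hq A hA hAb) (hq B hB hBb) h)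
  have hcent : Subgroup.centralizer (N : Set G) = ⊥ := by
    by_contra hC
    have hCn : (Subgroup.centralizer (N : Set G)).Normal := inferInstance
    have h1 := hinf _ N hCn hN hC hNbot
    have h2 := hNmin _ (Subgroup.normal_inf_normal _ _) h1 inf_le_right
    have h3 : N ≤ Subgroup.centralizer (N : Set G) := inf_eq_right.1 h2
    have h4 : Group.IsSolvable N := Group.isSolvable_of_comm fun a b => by
      have := (Subgroup.mem_centralizer_iff.1 (h3 b.2)) a a.2
      exact Subtype.ext this
    have h5 : Group.IsSolvable (G ⧸ N) := hq N hN hNbot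
    apply hns
    apply Group.isSolvable_of_ker_le_range N.subtype (QuotientGroup.mk' N)
    rw [QuotientGroup.ker_mk', Subgroup.range_subtype]
  refine ⟨?_, aux_minnormal G N hN hNbot hNmin hcent, hq N hN hNbot, hcent, ?_⟩
  · intro M hM hMb hMmin
    have h1 := hinf M N hM hN hMb hNbot
    have h2 : (M ⊓ N).Normal := Subgroup.normal_inf_normal _ _
    rw [← hMmin _ h2 h1 inf_le_left]
    exact hNmin _ h2 h1 inf_le_right
  · refine ⟨MulAut.conjNormal, ?_, fun g n => MulAut.conjNormal_apply g n⟩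
    rw [injective_iff_map_eq_one]
    intro g hg
    have : g ∈ Subgroup.centralizer (N : Set G) := by
      rw [Subgroup.mem_centralizer_iff]
      intro n hn
      have h1 := MulAut.conjNormal_apply g (⟨n, hn⟩ : N)
      rw [hg] at h1
      exact eq_mul_inv_iff_mul_eq.1 h1
    rwa [hcent, Subgroup.mem_bot] at this
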